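/- Let N ≥ 2, δ ≥ 0, let ρ be a density matrix on ℂ^N, let O be an N×N complex Hermitian matrix with ‖O‖_∞ ≤ 1, and let ν be a Borel probability measure on U(N) such that |∫ (tr(O U ρ U†))² dν(U) − ∫ (tr(O U ρ U†))² dμ_H(U)| ≤ δ and |∫ tr(O U ρ U†) dν(U) − ∫ tr(O U ρ U†) dμ_H(U)| ≤ δ. Then the variance of tr(O U ρ U†) over U ∼ ν is at most 1/(N+1) + 3δ: ∫ (tr(O U ρ U†))² dν(U) − (∫ tr(O U ρ U†) dν(U))² ≤ 1/(N+1) + 3δ. -/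

import Mathlib

open MeasureTheory Matrix
open scoped ComplexOrder

attribute [local instance] Matrix.frobeniusNormedAddCommGroup Matrix.frobeniusNormedSpace

/-- The Borel measurable-space structure on matrices (the product σ-algebra). -/
instance matrixMeasurableSpace {m n α : Type*} [MeasurableSpace α] :
    MeasurableSpace (Matrix m n α) :=
  inferInstanceAs (MeasurableSpace (m → n → α))

noncomputable section

/-- The (real) expectation value `tr(O U ρ U†)` of an observable `O` on the state `ρ`
after evolution by the unitary `U`. -/
def expVal {N : ℕ} (O ρ : Matrix (Fin N) (Fin N) ℂ)
    (U : Matrix.unitaryGroup (Fin N) ℂ) : ℝ :=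
  (Matrix.trace (O * (U : Matrix (Fin N) (Fin N) ℂ) * ρ *
    (U : Matrix (Fin N) (Fin N) ℂ)ᴴ)).re

section UnitaryMoments

variable {N : ℕ}

theorem measurable_unitaryGroup_entry (i j : Fin N) :
    Measurable fun U : Matrix.unitaryGroup (Fin N) ℂ => U.1 i j :=
  (measurable_pi_apply j).comp ((measurable_pi_apply i).comp measurable_subtype_coe)

theorem measurable_unitaryGroup_of_entry
    {f : Matrix.unitaryGroup (Fin N) ℂ → Matrix.unitaryGroup (Fin N) ℂ}
    (h : ∀ i j, Measurable fun U => (f U).1 i j) : Measurable f :=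
  Measurable.subtype_mk (measurable_pi_lambda _ fun i => measurable_pi_lambda _ fun j => h i j)

instance unitaryGroup_measurableMul : MeasurableMul (Matrix.unitaryGroup (Fin N) ℂ) where
  measurable_const_mul c := by
    refine measurable_unitaryGroup_of_entry fun i j => ?_
    simp only [Submonoid.coe_mul, Matrix.mul_apply]
    exact Finset.measurable_sum _ fun k _ => (measurable_unitaryGroup_entry k j).const_mul _
  measurable_mul_const c := by
    refine measurable_unitaryGroup_of_entry fun i j => ?_
    simp only [Submonoid.coe_mul, Matrix.mul_apply]
    exact Finset.measurable_sum _ fun k _ => (measurable_unitaryGroup_entry i k).mul_const _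

/-- The squared modulus of an entry of a unitary matrix. -/
def entryWeight (i j : Fin N) (U : Matrix.unitaryGroup (Fin N) ℂ) : ℝ :=
  Complex.normSq (U.1 i j)

theorem entryWeight_nonneg (i j : Fin N) (U : Matrix.unitaryGroup (Fin N) ℂ) :
    0 ≤ entryWeight i j U :=
  Complex.normSq_nonneg _

theorem entryWeight_le_one (i j : Fin N) (U : Matrix.unitaryGroup (Fin N) ℂ) :
    entryWeight i j U ≤ 1 := by
  rw [entryWeight, Complex.normSq_eq_norm_sq]
  exact pow_le_one₀ (norm_nonneg _) (entry_norm_bound_of_unitary U.2 i j)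

theorem sum_entryWeight_col (j : Fin N) (U : Matrix.unitaryGroup (Fin N) ℂ) :
    ∑ i, entryWeight i j U = 1 := by
  have h := congrFun (congrFun (Matrix.mem_unitaryGroup_iff'.mp U.2) j) j
  simp only [Matrix.mul_apply, Matrix.star_apply, Matrix.one_apply_eq] at h
  have h' := congrArg Complex.re h
  simpa [entryWeight, Complex.normSq_apply] using h'

theorem measurable_entryWeight (i j : Fin N) :
    Measurable (entryWeight i j : Matrix.unitaryGroup (Fin N) ℂ → ℝ) :=
  Complex.continuous_normSq.measurable.comp (measurable_unitaryGroup_entry i j)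

theorem sum_mul_entryWeight_sq (o : Fin N → ℝ) (j : Fin N)
    (U : Matrix.unitaryGroup (Fin N) ℂ) :
    (∑ i, o i * entryWeight i j U) ^ 2
      = ∑ i, ∑ k, o i * o k * (entryWeight i j U * entryWeight k j U) := by
  rw [pow_two, Finset.sum_mul_sum]
  exact Finset.sum_congr rfl fun i _ => Finset.sum_congr rfl fun k _ => by ring

/-- For a unimodular `z`, the unitary matrix `(1 + z) / 2 + (1 - z) / 2 • S`, where `S` swaps
the coordinates `i` and `k`. -/
def swapRotation (i k : Fin N) (z : ℂ) (hz : z * star z = 1) :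
    Matrix.unitaryGroup (Fin N) ℂ :=
  ⟨((1 + z) / 2) • (1 : Matrix (Fin N) (Fin N) ℂ)
      + ((1 - z) / 2) • (Equiv.swap i k).permMatrix ℂ, by
    have hS : (Equiv.swap i k).permMatrix ℂ * (Equiv.swap i k).permMatrix ℂ
        = (1 : Matrix (Fin N) (Fin N) ℂ) := by
      rw [← Matrix.permMatrix_mul, Equiv.swap_mul_self, Matrix.permMatrix_one]
    have hS' : star ((Equiv.swap i k).permMatrix ℂ : Matrix (Fin N) (Fin N) ℂ)
        = (Equiv.swap i k).permMatrix ℂ := by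
      rw [Matrix.star_eq_conjTranspose, Matrix.conjTranspose_permMatrix, Equiv.swap_inv]
    rw [Matrix.mem_unitaryGroup_iff]
    simp only [star_add, star_smul, hS', star_one, add_mul, mul_add, smul_mul_smul_comm, hS,
      one_mul, mul_one]
    simp only [star_div₀, star_add, star_sub, star_one, star_ofNat]
    set w := star z
    have h1 : (1 + z) / 2 * ((1 + w) / 2) + (1 - z) / 2 * ((1 - w) / 2) = 1 := by
      linear_combination hz / 2
    have h2 : (1 - z) / 2 * ((1 + w) / 2) + (1 + z) / 2 * ((1 - w) / 2) = 0 := by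
      linear_combination -hz / 2
    rw [show ∀ (a b c d : ℂ) (S : Matrix (Fin N) (Fin N) ℂ),
      a • (1 : Matrix (Fin N) (Fin N) ℂ) + b • S + (c • S + d • (1 : Matrix (Fin N) (Fin N) ℂ))
        = (a + d) • (1 : Matrix (Fin N) (Fin N) ℂ) + (b + c) • S from fun a b c d S => by module]
    rw [h1, h2, one_smul, zero_smul, add_zero]⟩

theorem swapRotation_mul_apply (i k : Fin N) (z : ℂ) (hz : z * star z = 1)
    (U : Matrix.unitaryGroup (Fin N) ℂ) (l j : Fin N) :
    (swapRotation i k z hz * U).1 l j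
      = (1 + z) / 2 * U.1 l j + (1 - z) / 2 * U.1 (Equiv.swap i k l) j := by
  simp [swapRotation, add_mul, Equiv.Perm.permMatrix, PEquiv.toMatrix_toPEquiv_mul]

/-- The diagonal unitary matrix multiplying the coordinate `k` by the imaginary unit. -/
def quarterPhase (k : Fin N) : Matrix.unitaryGroup (Fin N) ℂ :=
  ⟨Matrix.diagonal fun l => if l = k then Complex.I else 1, by
    rw [Matrix.mem_unitaryGroup_iff, Matrix.star_eq_conjTranspose, Matrix.diagonal_conjTranspose,
      Matrix.diagonal_mul_diagonal, ← Matrix.diagonal_one]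
    congr 1
    ext l
    by_cases h : l = k <;> simp [h]⟩

theorem quarterPhase_mul_apply (k : Fin N) (U : Matrix.unitaryGroup (Fin N) ℂ) (l j : Fin N) :
    (quarterPhase k * U).1 l j = (if l = k then Complex.I else 1) * U.1 l j := by
  simp [quarterPhase, Matrix.diagonal_mul]

theorem integral_entryWeight_sq_eq (μ : Measure (Matrix.unitaryGroup (Fin N) ℂ))
    [μ.IsMulLeftInvariant] (i k j : Fin N) :
    ∫ U, entryWeight i j U * entryWeight i j U ∂μ
      = ∫ U, entryWeight k j U * entryWeight k j U ∂μ := by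
  rw [← integral_mul_left_eq_self _ (swapRotation i k (-1) (by simp))]
  congr 1
  ext U
  have h := swapRotation_mul_apply i k (-1) (by simp) U i j
  simp only [entryWeight]
  rw [h, Equiv.swap_apply_left]
  norm_num

section Moments

variable (μ : Measure (Matrix.unitaryGroup (Fin N) ℂ)) [IsProbabilityMeasure μ]

theorem integrable_entryWeight (i j : Fin N) : Integrable (entryWeight i j) μ :=
  Integrable.of_bound (measurable_entryWeight i j).aestronglyMeasurable 1
    (Filter.Eventually.of_forall fun U => by
      rw [Real.norm_of_nonneg (entryWeight_nonneg i j U)]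
      exact entryWeight_le_one i j U)

theorem integrable_entryWeight_mul (i k j l : Fin N) :
    Integrable (fun U => entryWeight i j U * entryWeight k l U) μ :=
  Integrable.of_bound
    ((measurable_entryWeight i j).mul (measurable_entryWeight k l)).aestronglyMeasurable 1
    (Filter.Eventually.of_forall fun U => by
      rw [Real.norm_of_nonneg (mul_nonneg (entryWeight_nonneg i j U) (entryWeight_nonneg k l U))]
      exact mul_le_one₀ (entryWeight_le_one i j U) (entryWeight_nonneg k l U)
        (entryWeight_le_one k l U))

theorem sum_integral_entryWeight_mul (i j : Fin N) :
    ∑ k, ∫ U, entryWeight i j U * entryWeight k j U ∂μ = ∫ U, entryWeight i j U ∂μ := by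
  rw [← integral_finsetSum _ fun k _ => integrable_entryWeight_mul μ i k j j]
  simp only [← Finset.mul_sum, sum_entryWeight_col, mul_one]

theorem integrable_sum_mul_entryWeight_sq (o : Fin N → ℝ) (j : Fin N) :
    Integrable (fun U => (∑ i, o i * entryWeight i j U) ^ 2) μ := by
  simp only [sum_mul_entryWeight_sq]
  exact integrable_finsetSum _ fun i _ => integrable_finsetSum _ fun k _ =>
    (integrable_entryWeight_mul μ i k j j).const_mul _

variable [μ.IsMulLeftInvariant]

theorem integral_entryWeight_mul_of_ne {i k : Fin N} (hik : i ≠ k) (j : Fin N) :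
    ∫ U, entryWeight i j U * entryWeight k j U ∂μ
      = (∫ U, entryWeight i j U * entryWeight i j U ∂μ) / 2 := by
  have hI : Complex.I * star Complex.I = 1 := by simp
  have hplus : ∫ U, entryWeight i j U * entryWeight k j U ∂μ
      = ∫ U, Complex.normSq (U.1 i j ^ 2 + U.1 k j ^ 2) / 4 ∂μ := by
    rw [← integral_mul_left_eq_self _ (swapRotation i k Complex.I hI)]
    congr 1
    ext U
    simp only [entryWeight]
    rw [swapRotation_mul_apply, swapRotation_mul_apply, Equiv.swap_apply_left,
      Equiv.swap_apply_right, ← Complex.normSq_mul]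
    generalize U.1 i j = a
    generalize U.1 k j = b
    have : ((1 + Complex.I) / 2 * a + (1 - Complex.I) / 2 * b)
        * ((1 + Complex.I) / 2 * b + (1 - Complex.I) / 2 * a) = (a ^ 2 + b ^ 2) / 2 := by
      linear_combination (a * b / 2 - a ^ 2 / 4 - b ^ 2 / 4) * Complex.I_sq
    rw [this, Complex.normSq_div]
    norm_num
  have hminus : ∫ U, Complex.normSq (U.1 i j ^ 2 + U.1 k j ^ 2) / 4 ∂μ
      = ∫ U, Complex.normSq (U.1 i j ^ 2 - U.1 k j ^ 2) / 4 ∂μ := by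
    rw [← integral_mul_left_eq_self _ (quarterPhase k)]
    congr 1
    ext U
    rw [quarterPhase_mul_apply, quarterPhase_mul_apply, if_neg hik, if_pos rfl, one_mul, mul_pow,
      Complex.I_sq, neg_one_mul, ← sub_eq_add_neg]
  have hparallel (U : Matrix.unitaryGroup (Fin N) ℂ) :
      Complex.normSq (U.1 i j ^ 2 - U.1 k j ^ 2) / 4
      = (entryWeight i j U * entryWeight i j U + entryWeight k j U * entryWeight k j U) / 2
        - Complex.normSq (U.1 i j ^ 2 + U.1 k j ^ 2) / 4 := by
    simp only [entryWeight, Complex.normSq_apply, pow_two, Complex.add_re, Complex.add_im,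
      Complex.sub_re, Complex.sub_im, Complex.mul_re, Complex.mul_im]
    ring
  have hcont : Integrable (fun U : Matrix.unitaryGroup (Fin N) ℂ =>
      Complex.normSq (U.1 i j ^ 2 + U.1 k j ^ 2) / 4) μ := by
    refine Integrable.of_bound (C := 1) (Measurable.aestronglyMeasurable ?_)
      (Filter.Eventually.of_forall fun U => ?_)
    · exact (Complex.continuous_normSq.measurable.comp
        (((measurable_unitaryGroup_entry i j).pow_const 2).add
          ((measurable_unitaryGroup_entry k j).pow_const 2))).div_const 4
    · have h1 := Complex.normSq_nonneg (U.1 i j ^ 2 + U.1 k j ^ 2)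
      have h2 := Complex.normSq_nonneg (U.1 i j ^ 2 - U.1 k j ^ 2)
      have h3 := hparallel U
      have h4 := entryWeight_nonneg i j U
      have h5 := entryWeight_nonneg k j U
      have h6 := entryWeight_le_one i j U
      have h7 := entryWeight_le_one k j U
      rw [Real.norm_of_nonneg (by positivity)]
      nlinarith
  have hsum : ∫ U, Complex.normSq (U.1 i j ^ 2 - U.1 k j ^ 2) / 4 ∂μ
      = ((∫ U, entryWeight i j U * entryWeight i j U ∂μ)
        + ∫ U, entryWeight k j U * entryWeight k j U ∂μ) / 2
        - ∫ U, Complex.normSq (U.1 i j ^ 2 + U.1 k j ^ 2) / 4 ∂μ := by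
    have hi := integrable_entryWeight_mul μ i i j j
    have hk := integrable_entryWeight_mul μ k k j j
    simp only [hparallel]
    rw [integral_sub (by exact (hi.add hk).div_const 2) hcont, integral_div, integral_add hi hk]
  have heq := integral_entryWeight_sq_eq μ i k j
  linarith

/-- The second moments of the squared moduli of the entries of a column of a Haar-random
unitary matrix. -/
theorem integral_entryWeight_mul (i k j : Fin N) :
    ∫ U, entryWeight i j U * entryWeight k j U ∂μ
      = (1 + if i = k then 1 else 0) / ((N : ℝ) * (N + 1)) := by
  have hN : (0 : ℝ) < N := by exact_mod_cast Fin.pos i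
  set a := ∫ U, entryWeight i j U * entryWeight i j U ∂μ with ha
  have hB (l m : Fin N) : ∫ U, entryWeight l j U * entryWeight m j U ∂μ
      = a / 2 * (1 + if l = m then 1 else 0) := by
    split_ifs with h
    · subst h
      rw [integral_entryWeight_sq_eq μ l i j]
      ring
    · rw [integral_entryWeight_mul_of_ne μ h, integral_entryWeight_sq_eq μ l i j]
      ring
  have htotal : ∑ l, ∑ m, ∫ U, entryWeight l j U * entryWeight m j U ∂μ = 1 := by
    simp only [sum_integral_entryWeight_mul]
    rw [← integral_finsetSum _ fun l _ => integrable_entryWeight μ l j]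
    simp [sum_entryWeight_col]
  simp only [hB, ← Finset.mul_sum, Finset.sum_add_distrib] at htotal
  simp at htotal
  rw [hB]
  have : a / 2 = 1 / ((N : ℝ) * (N + 1)) := by
    rw [eq_div_iff (by positivity)]
    linarith
  rw [this]
  ring

theorem integral_entryWeight (i j : Fin N) :
    ∫ U, entryWeight i j U ∂μ = 1 / (N : ℝ) := by
  have hN : (0 : ℝ) < N := by exact_mod_cast Fin.pos i
  rw [← sum_integral_entryWeight_mul]
  simp only [integral_entryWeight_mul, ← Finset.sum_div, Finset.sum_add_distrib]
  simp
  field_simp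

theorem integral_sum_mul_entryWeight (o : Fin N → ℝ) (j : Fin N) :
    ∫ U, ∑ i, o i * entryWeight i j U ∂μ = (∑ i, o i) / N := by
  rw [integral_finsetSum _ fun i _ => (integrable_entryWeight μ i j).const_mul _]
  simp only [integral_const_mul, integral_entryWeight, ← Finset.sum_mul]
  ring

theorem integral_sum_mul_entryWeight_sq (o : Fin N → ℝ) (j : Fin N) :
    ∫ U, (∑ i, o i * entryWeight i j U) ^ 2 ∂μ
      = ((∑ i, o i) ^ 2 + ∑ i, o i ^ 2) / ((N : ℝ) * (N + 1)) := by
  simp only [sum_mul_entryWeight_sq]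
  rw [integral_finsetSum _ fun i _ => integrable_finsetSum _ fun k _ =>
    (integrable_entryWeight_mul μ i k j j).const_mul _]
  simp only [integral_finsetSum _ fun k _ =>
    (integrable_entryWeight_mul μ _ k j j).const_mul _, integral_const_mul,
    integral_entryWeight_mul, mul_div_assoc', ← Finset.sum_div]
  congr 1
  simp only [mul_add, Finset.sum_add_distrib, mul_one, pow_two, Finset.sum_mul_sum]
  simp

/-- The Haar variance of a mixture of diagonal expectation values is at most `1 / (N + 1)`. -/
theorem haar_variance_mixture_le (o p : Fin N → ℝ) (ho : ∀ i, |o i| ≤ 1) (hp : ∀ j, 0 ≤ p j)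
    (hp1 : ∑ j, p j = 1) (hN : 0 < N) :
    (∫ U, (∑ j, p j * ∑ i, o i * entryWeight i j U) ^ 2 ∂μ)
      - (∫ U, ∑ j, p j * ∑ i, o i * entryWeight i j U ∂μ) ^ 2 ≤ 1 / ((N : ℝ) + 1) := by
  have hN' : (0 : ℝ) < N := by exact_mod_cast hN
  have hmean : ∫ U, ∑ j, p j * ∑ i, o i * entryWeight i j U ∂μ = (∑ i, o i) / N := by
    rw [integral_finsetSum _ fun j _ => (integrable_finsetSum _ fun i _ =>
      (integrable_entryWeight μ i j).const_mul _).const_mul _]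
    simp only [integral_const_mul, integral_sum_mul_entryWeight, ← Finset.sum_mul, hp1, one_mul]
  have hsq : ∫ U, (∑ j, p j * ∑ i, o i * entryWeight i j U) ^ 2 ∂μ
      ≤ ((∑ i, o i) ^ 2 + ∑ i, o i ^ 2) / ((N : ℝ) * (N + 1)) := by
    have hsqint (j : Fin N) := (integrable_sum_mul_entryWeight_sq μ o j).const_mul (p j)
    calc _ ≤ ∫ U, ∑ j, p j * (∑ i, o i * entryWeight i j U) ^ 2 ∂μ := by
          refine integral_mono_of_nonneg (Filter.Eventually.of_forall fun U => sq_nonneg _)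
            (integrable_finsetSum _ fun j _ => hsqint j) (Filter.Eventually.of_forall fun U => ?_)
          exact (even_two.convexOn_pow (𝕜 := ℝ)).map_sum_le (fun j _ => hp j) hp1
            (fun j _ => Set.mem_univ _)
      _ = _ := by
          rw [integral_finsetSum _ fun j _ => hsqint j]
          simp only [integral_const_mul, integral_sum_mul_entryWeight_sq, ← Finset.sum_mul, hp1,
            one_mul]
  have hQ : ∑ i, o i ^ 2 ≤ N := by
    calc ∑ i, o i ^ 2 ≤ ∑ _i : Fin N, (1 : ℝ) :=
          Finset.sum_le_sum fun i _ => (sq_le_one_iff_abs_le_one _).mpr (ho i)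
      _ = N := by simp
  rw [hmean]
  set S := ∑ i, o i
  have hS : S ^ 2 / (N * (N + 1)) ≤ (S / N) ^ 2 := by
    rw [div_pow]
    gcongr
    nlinarith
  have hQ' : (∑ i, o i ^ 2) / ((N : ℝ) * (N + 1)) ≤ 1 / ((N : ℝ) + 1) := by
    rw [div_le_div_iff₀ (by positivity) (by positivity)]
    nlinarith
  rw [add_div] at hsq
  linarith

end Moments

theorem abs_sum_mul_entryWeight_le_one (o p : Fin N → ℝ) (ho : ∀ i, |o i| ≤ 1)
    (hp : ∀ j, 0 ≤ p j) (hp1 : ∑ j, p j = 1) (U : Matrix.unitaryGroup (Fin N) ℂ) :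
    |∑ j, p j * ∑ i, o i * entryWeight i j U| ≤ 1 := by
  have hcol (j : Fin N) : |∑ i, o i * entryWeight i j U| ≤ 1 := by
    calc _ ≤ ∑ i, |o i * entryWeight i j U| := Finset.abs_sum_le_sum_abs _ _
      _ ≤ ∑ i, entryWeight i j U := Finset.sum_le_sum fun i _ => by
          rw [abs_mul, abs_of_nonneg (entryWeight_nonneg i j U)]
          exact mul_le_of_le_one_left (entryWeight_nonneg i j U) (ho i)
      _ = 1 := sum_entryWeight_col j U
  calc _ ≤ ∑ j, |p j * ∑ i, o i * entryWeight i j U| := Finset.abs_sum_le_sum_abs _ _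
    _ ≤ ∑ j, p j := Finset.sum_le_sum fun j _ => by
        rw [abs_mul, abs_of_nonneg (hp j)]
        exact mul_le_of_le_one_right (hp j) (hcol j)
    _ = 1 := hp1

theorem abs_eigenvalues_le_one {O : Matrix (Fin N) (Fin N) ℂ} (hO : O.IsHermitian)
    (hOnorm : ‖Matrix.toEuclideanCLM (𝕜 := ℂ) O‖ ≤ 1) (i : Fin N) : |hO.eigenvalues i| ≤ 1 := by
  have h := (Matrix.toEuclideanCLM (𝕜 := ℂ) O).le_of_opNorm_le hOnorm (hO.eigenvectorBasis i)
  have h' : Matrix.toEuclideanCLM (𝕜 := ℂ) O (hO.eigenvectorBasis i)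
      = hO.eigenvalues i • hO.eigenvectorBasis i :=
    congrArg (WithLp.toLp 2) (hO.mulVec_eigenvectorBasis i)
  rw [h', norm_smul, hO.eigenvectorBasis.norm_eq_one] at h
  simpa using h

theorem expVal_eq_sum_entryWeight {O ρ : Matrix (Fin N) (Fin N) ℂ} (hO : O.IsHermitian)
    (hρ : ρ.IsHermitian) (U : Matrix.unitaryGroup (Fin N) ℂ) :
    expVal O ρ U = ∑ j, hρ.eigenvalues j * ∑ i, hO.eigenvalues i *
      entryWeight i j (star hO.eigenvectorUnitary * (U * hρ.eigenvectorUnitary)) := by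
  set W := hO.eigenvectorUnitary with hW
  set V := hρ.eigenvectorUnitary with hV
  set Y := star W * (U * V) with hY
  have hYc : Y.1 = star W.1 * U.1 * V.1 := by
    rw [hY]
    simp [mul_assoc]
  have hYs : (Y.1)ᴴ = star V.1 * (U.1)ᴴ * W.1 := by
    rw [hYc, ← Matrix.star_eq_conjTranspose, star_mul, star_mul, star_star, mul_assoc,
      Matrix.star_eq_conjTranspose U.1]
  have htr : Matrix.trace (O * U.1 * ρ * (U.1)ᴴ)
      = Matrix.trace (Matrix.diagonal (fun i => (hO.eigenvalues i : ℂ)) * Y.1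
        * Matrix.diagonal (fun j => (hρ.eigenvalues j : ℂ)) * (Y.1)ᴴ) := by
    have h1 := hO.spectral_theorem
    have h2 := hρ.spectral_theorem
    rw [Unitary.conjStarAlgAut_apply] at h1 h2
    conv_lhs => rw [h1, h2]
    rw [hYs, hYc, ← hW, ← hV]
    simp only [mul_assoc]
    rw [Matrix.trace_mul_comm]
    simp only [mul_assoc]
    rfl
  rw [expVal, htr, Matrix.trace]
  simp only [Matrix.diag_apply, Matrix.mul_apply (N := (Y.1)ᴴ), Matrix.mul_diagonal,
    Matrix.diagonal_mul, Matrix.conjTranspose_apply, Complex.re_sum, Finset.mul_sum]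
  rw [Finset.sum_comm]
  refine Finset.sum_congr rfl fun j _ => Finset.sum_congr rfl fun i _ => ?_
  simp only [entryWeight, Complex.normSq_apply, Complex.mul_re, Complex.mul_im,
    Complex.ofReal_re, Complex.ofReal_im, Complex.star_def, Complex.conj_re, Complex.conj_im]
  ring

end UnitaryMoments

/-- If the first and second moments of `tr(O U ρ U†)` over a Borel probability
measure `ν` on `U(N)` (`N ≥ 2`) are `δ`-close to the corresponding Haar moments, then the
variance of `tr(O U ρ U†)` over `ν` is at most `1/(N+1) + 3δ`. -/
theorem variance_le_of_moments_close (N : ℕ) (hN : 2 ≤ N) (δ : ℝ) (hδ : 0 ≤ δ)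
    (ρ O : Matrix (Fin N) (Fin N) ℂ)
    (hρ : ρ.PosSemidef) (hρtr : ρ.trace = 1) (hO : O.IsHermitian)
    (hOnorm : ‖Matrix.toEuclideanCLM (𝕜 := ℂ) O‖ ≤ 1)
    (μH ν : Measure (Matrix.unitaryGroup (Fin N) ℂ))
    [IsProbabilityMeasure μH] [μH.IsMulLeftInvariant] [μH.IsMulRightInvariant]
    [IsProbabilityMeasure ν]
    (hmom2 : |(∫ U, (expVal O ρ U) ^ 2 ∂ν) - ∫ U, (expVal O ρ U) ^ 2 ∂μH| ≤ δ)
    (hmom1 : |(∫ U, expVal O ρ U ∂ν) - ∫ U, expVal O ρ U ∂μH| ≤ δ) :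
    (∫ U, (expVal O ρ U) ^ 2 ∂ν) - (∫ U, expVal O ρ U ∂ν) ^ 2
      ≤ 1 / ((N : ℝ) + 1) + 3 * δ := by
  set o := hO.eigenvalues
  set p := hρ.1.eigenvalues
  have ho : ∀ i, |o i| ≤ 1 := abs_eigenvalues_le_one hO hOnorm
  have hp : ∀ j, 0 ≤ p j := hρ.eigenvalues_nonneg
  have hp1 : ∑ j, p j = 1 := by
    have h := hρ.1.trace_eq_sum_eigenvalues
    rw [hρtr] at h
    have h' := congrArg Complex.re h
    rw [Complex.one_re, Complex.re_sum] at h'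
    exact h'.symm
  let g (U : Matrix.unitaryGroup (Fin N) ℂ) : ℝ := ∑ j, p j * ∑ i, o i * entryWeight i j U
  have hexp (U) : expVal O ρ U
      = g (star hO.eigenvectorUnitary * (U * hρ.1.eigenvectorUnitary)) :=
    expVal_eq_sum_entryWeight hO hρ.1 U
  have hinv (F : Matrix.unitaryGroup (Fin N) ℂ → ℝ) :
      ∫ U, F (star hO.eigenvectorUnitary * (U * hρ.1.eigenvectorUnitary)) ∂μH
        = ∫ U, F U ∂μH := by
    rw [integral_mul_right_eq_self (fun U => F (star hO.eigenvectorUnitary * U)),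
      integral_mul_left_eq_self]
  have hvar : (∫ U, (expVal O ρ U) ^ 2 ∂μH) - (∫ U, expVal O ρ U ∂μH) ^ 2
      ≤ 1 / ((N : ℝ) + 1) := by
    simp only [hexp]
    rw [hinv g, hinv fun U => g U ^ 2]
    exact haar_variance_mixture_le μH o p ho hp hp1 (by omega)
  have hbound (μ : Measure (Matrix.unitaryGroup (Fin N) ℂ)) [IsProbabilityMeasure μ] :
      |∫ U, expVal O ρ U ∂μ| ≤ 1 := by
    have h := norm_integral_le_of_norm_le_const (μ := μ) (f := expVal O ρ) (C := 1)
      (Filter.Eventually.of_forall fun U => by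
        rw [hexp]
        exact abs_sum_mul_entryWeight_le_one o p ho hp hp1 _)
    simpa using h
  have hν := abs_le.mp (hbound ν)
  have hH := abs_le.mp (hbound μH)
  have h2 := abs_le.mp hmom2
  have hdiff : |(∫ U, expVal O ρ U ∂ν) ^ 2 - (∫ U, expVal O ρ U ∂μH) ^ 2| ≤ δ * 2 := by
    rw [sq_sub_sq, mul_comm, abs_mul]
    exact mul_le_mul hmom1 (abs_le.mpr ⟨by linarith, by linarith⟩) (abs_nonneg _) hδ
  have h1 := abs_le.mp hdiff
  linarith

end
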